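/- arXiv:2407.01207 — 2 statements merged into one kernel-verified Lean document; each statement's English description precedes it below -/
import Mathlib

section
/- If A is a hereditary abelian category, then any thick subcategory of A (closed under direct summands and satisfying the 2-of-3 condition for short exact sequences) is wide, i.e. closed under kernels, cokernels, and extensions. -/
open CategoryTheory Limits Abelian

universe w v u

open Pretriangulated DerivedCategory in
/-- Every class in `Ext¹(Q, X)` is killed by some monomorphism out of `X`. -/
lemma thickAux_efface {C : Type u} [Category.{v} C] [Abelian C] [HasExt.{w} C]
    {Q X : C} (x : Ext Q X 1) :
    ∃ (E : C) (j : X ⟶ E), Mono j ∧ x.comp (Ext.mk₀ j) (add_zero 1) = 0 := by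
  let := HasDerivedCategory.standard C
  let h : (singleFunctor C 0).obj Q ⟶ ((singleFunctor C 0).obj X)⟦(1 : ℤ)⟧ := x.hom
  obtain ⟨Z, f, g, hT⟩ := distinguished_cocone_triangle₂ h
  have hLE : Z.IsLE 0 :=
    TStructure.t.isLE₂ _ hT 0 (inferInstanceAs (((singleFunctor C 0).obj X).IsLE 0))
      (inferInstanceAs (((singleFunctor C 0).obj Q).IsLE 0))
  have hGE : Z.IsGE 0 :=
    TStructure.t.isGE₂ _ hT 0 (inferInstanceAs (((singleFunctor C 0).obj X).IsGE 0))
      (inferInstanceAs (((singleFunctor C 0).obj Q).IsGE 0))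
  obtain ⟨E, ⟨e⟩⟩ := exists_iso_singleFunctor_obj_of_isGE_of_isLE Z 0
  obtain ⟨j, hj⟩ := (singleFunctor C 0).map_surjective (f ≫ e.hom)
  refine ⟨E, j, ?_, ?_⟩
  · apply Preadditive.mono_of_cancel_zero
    intro T t ht
    apply (singleFunctor C 0).map_injective
    rw [Functor.map_zero]
    have h1 : (singleFunctor C 0).map t ≫ f = 0 := by
      rw [← cancel_mono e.hom, Category.assoc, ← hj, ← Functor.map_comp, ht]
      simp
    have h2 : ((singleFunctor C 0).map t)⟦(1 : ℤ)⟧' ≫ f⟦(1 : ℤ)⟧' = 0 := by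
      rw [← Functor.map_comp, h1, Functor.map_zero]
    obtain ⟨k, hk⟩ : ∃ k : ((singleFunctor C 0).obj T)⟦(1 : ℤ)⟧ ⟶ (singleFunctor C 0).obj Q,
        ((singleFunctor C 0).map t)⟦(1 : ℤ)⟧' = k ≫ h :=
      Triangle.coyoneda_exact₁ _ hT (((singleFunctor C 0).map t)⟦(1 : ℤ)⟧') h2
    have hk0 : k = 0 := TStructure.t.zero_of_isLE_of_isGE k (-1) 0 (by lia)
      (TStructure.t.isLE_shift ((singleFunctor C 0).obj T) 0 1 (-1))
      (inferInstanceAs (((singleFunctor C 0).obj Q).IsGE 0))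
    apply (shiftFunctor (DerivedCategory C) (1 : ℤ)).map_injective
    rw [hk, hk0, zero_comp, Functor.map_zero]
  · apply Ext.ext
    rw [Ext.comp_hom, Ext.mk₀_hom, ShiftedHom.comp_mk₀, hj, Ext.zero_hom, Functor.map_comp]
    have := comp_distTriang_mor_zero₃₁ _ hT
    change h ≫ f⟦(1 : ℤ)⟧' = 0 at this
    change h ≫ f⟦(1 : ℤ)⟧' ≫ _ = 0
    rw [← Category.assoc, this, zero_comp]

/-- Every class in `Ext¹(Q, X)` is realized by a short exact sequence. -/
lemma thickAux_realize {C : Type u} [Category.{v} C] [Abelian C] [HasExt.{w} C]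
    {Q X : C} (x : Ext Q X 1) :
    ∃ (E : C) (a : X ⟶ E) (b : E ⟶ Q) (hab : a ≫ b = 0)
      (hS : (ShortComplex.mk a b hab).ShortExact), hS.extClass = x := by
  obtain ⟨J, j, _, hj⟩ := thickAux_efface x
  have hT : (ShortComplex.mk j (cokernel.π j) (cokernel.condition j)).ShortExact :=
    { exact := ShortComplex.exact_cokernel j }
  obtain ⟨φ, hφ⟩ := Ext.covariant_sequence_exact₁ Q hT x hj (zero_add 1)
  obtain ⟨φ, rfl⟩ := (Ext.mk₀_bijective _ _).2 φ
  dsimp at φ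
  let a : X ⟶ pullback (cokernel.π j) φ := pullback.lift j 0 (by simp)
  have haj : a ≫ pullback.fst _ _ = j := pullback.lift_fst _ _ _
  have hab : a ≫ pullback.snd _ _ = 0 := pullback.lift_snd _ _ _
  have : Mono a := by
    have : Mono (a ≫ pullback.fst _ _) := by rw [haj]; infer_instance
    exact mono_of_mono a (pullback.fst _ _)
  have hS : (ShortComplex.mk a (pullback.snd (cokernel.π j) φ) hab).ShortExact :=
    { exact := by
        rw [ShortComplex.exact_iff_exact_up_to_refinements]
        intro A y hy
        dsimp at y hy
        have h0 : (y ≫ pullback.fst _ _) ≫ cokernel.π j = 0 := by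
          rw [Category.assoc, pullback.condition, reassoc_of% hy, zero_comp]
        refine ⟨A, 𝟙 A, inferInstance, hT.exact.lift (y ≫ pullback.fst _ _) h0, ?_⟩
        have h1 := hT.exact.lift_f (y ≫ pullback.fst _ _) h0
        dsimp at h1 ⊢
        apply pullback.hom_ext
        · simp only [Category.id_comp, Category.assoc, haj, h1]
        · simp only [Category.id_comp, Category.assoc, hab, hy, comp_zero] }
  refine ⟨_, a, pullback.snd _ _, hab, hS, ?_⟩
  have hn := ShortComplex.ShortExact.extClass_naturality hS hT
    { τ₁ := 𝟙 X
      τ₂ := pullback.fst _ _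
      τ₃ := φ
      comm₁₂ := by simp [haj]
      comm₂₃ := by simp [pullback.condition] }
  dsimp at hn
  rw [Ext.comp_mk₀_id] at hn
  rw [hn]
  exact hφ

/-- A morphism of short exact sequences with identity on the right gives a short exact
sequence `0 → X → E ⊞ I → Y → 0`. -/
lemma thickAux_square {C : Type u} [Category.{v} C] [Abelian C]
    {X E Q I Y : C} {a : X ⟶ E} {b : E ⟶ Q} (hab : a ≫ b = 0)
    (hS : (ShortComplex.mk a b hab).ShortExact) {i : I ⟶ Y} {q : Y ⟶ Q} (hiq : i ≫ q = 0)
    (hT : (ShortComplex.mk i q hiq).ShortExact) (p : X ⟶ I) (e : E ⟶ Y)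
    (h₁ : a ≫ e = p ≫ i) (h₂ : e ≫ q = b) :
    ∃ w : biprod.lift a p ≫ biprod.desc e (-i) = 0,
      (ShortComplex.mk (biprod.lift a p) (biprod.desc e (-i)) w).ShortExact := by
  have w : biprod.lift a p ≫ biprod.desc e (-i) = 0 := by simp [h₁]
  have : Mono a := hS.mono_f
  have : Epi b := hS.epi_g
  have : Mono i := hT.mono_f
  refine ⟨w, { exact := ?_, mono_f := ?_, epi_g := ?_ }⟩
  · rw [ShortComplex.exact_iff_exact_up_to_refinements]
    intro A t ht
    dsimp at t ht
    have ht' : (t ≫ biprod.fst) ≫ e = (t ≫ biprod.snd) ≫ i := by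
      have ht2 : t ≫ (biprod.fst ≫ e + biprod.snd ≫ (-i)) = 0 := by
        rw [← biprod.desc_eq]; exact ht
      simpa [← sub_eq_add_neg, sub_eq_zero] using ht2
    have h0 : (t ≫ biprod.fst) ≫ b = 0 := by
      rw [← h₂, ← Category.assoc, ht', Category.assoc, hiq, comp_zero]
    let s := hS.exact.lift (t ≫ biprod.fst) h0
    have hs : s ≫ a = t ≫ biprod.fst := hS.exact.lift_f _ h0
    refine ⟨A, 𝟙 A, inferInstance, s, ?_⟩
    dsimp
    apply biprod.hom_ext
    · simp [hs]
    · simp only [Category.id_comp, Category.assoc, biprod.lift_snd]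
      rw [← cancel_mono i, Category.assoc s, ← h₁, ← Category.assoc, hs, ht']
  · dsimp
    have : Mono (biprod.lift a p ≫ biprod.fst) := by rw [biprod.lift_fst]; infer_instance
    exact mono_of_mono _ biprod.fst
  · dsimp
    rw [epi_iff_surjective_up_to_refinements]
    intro A y
    obtain ⟨A', π, hπ, z, hz⟩ := surjective_up_to_refinements_of_epi b (y ≫ q)
    have h0 : (z ≫ e - π ≫ y) ≫ q = 0 := by
      rw [Preadditive.sub_comp, Category.assoc, Category.assoc, h₂, hz, sub_self]
    let s := hT.exact.lift _ h0
    have hs : s ≫ i = z ≫ e - π ≫ y := hT.exact.lift_f _ h0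
    refine ⟨A', π, hπ, biprod.lift z s, ?_⟩
    simp [hs]

/-- The key diagram. -/
lemma thickAux_key {C : Type u} [Category.{v} C] [Abelian C] [HasExt.{w} C]
    {K X I Y Q : C} (hered : Subsingleton (Ext Q K 2))
    {k : K ⟶ X} {p : X ⟶ I} (hkp : k ≫ p = 0) (hU : (ShortComplex.mk k p hkp).ShortExact)
    {i : I ⟶ Y} {q : Y ⟶ Q} (hiq : i ≫ q = 0) (hT : (ShortComplex.mk i q hiq).ShortExact) :
    ∃ (E : C) (f : X ⟶ E ⊞ I) (g : E ⊞ I ⟶ Y) (w : f ≫ g = 0),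
      (ShortComplex.mk f g w).ShortExact := by
  obtain ⟨x, hx⟩ := Ext.covariant_sequence_exact₃ Q hU hT.extClass (n₁ := 2) rfl
    (Subsingleton.elim _ _)
  obtain ⟨E, a, b, hab, hS, rfl⟩ := thickAux_realize x
  dsimp at hx
  obtain ⟨e, he⟩ := Ext.contravariant_sequence_exact₁ hS Y (Ext.mk₀ (p ≫ i)) (n₁ := 1) rfl (by
    rw [← Ext.mk₀_comp_mk₀, ← Ext.comp_assoc_of_third_deg_zero, hx]
    exact hT.extClass_comp)
  obtain ⟨e, rfl⟩ := (Ext.mk₀_bijective _ _).2 e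
  dsimp at e he
  rw [Ext.mk₀_comp_mk₀] at he
  replace he : a ≫ e = p ≫ i := (Ext.mk₀_bijective _ _).1 he
  have h0 : a ≫ e ≫ q = 0 := by rw [reassoc_of% he, hiq, comp_zero]
  have : Epi b := hS.epi_g
  let u : Q ⟶ Q := hS.exact.desc (e ≫ q) h0
  have hu : b ≫ u = e ≫ q := hS.exact.g_desc _ h0
  have hn := ShortComplex.ShortExact.extClass_naturality hS hT
    { τ₁ := p
      τ₂ := e
      τ₃ := u
      comm₁₂ := by simp [he]
      comm₂₃ := by simp [hu] }
  dsimp at hn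
  have hz : ∀ c : Ext Q I 1, c = (Ext.mk₀ u).comp c (zero_add 1) →
      (Ext.mk₀ (u + -𝟙 Q)).comp c (zero_add 1) = 0 := by
    intro c hc
    have hneg : Ext.mk₀ (-𝟙 Q) = - Ext.mk₀ (𝟙 Q) := by
      rw [eq_neg_iff_add_eq_zero, ← Ext.mk₀_add]; simp
    rw [Ext.mk₀_add, Ext.add_comp, hneg, Ext.neg_comp, Ext.mk₀_id_comp, ← hc, add_neg_cancel]
  obtain ⟨v, hv⟩ := Ext.covariant_sequence_exact₃ Q hT (Ext.mk₀ (u + -𝟙 Q)) (n₁ := 1)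
    (zero_add 1) (hz _ (hx.symm.trans hn))
  obtain ⟨v, rfl⟩ := (Ext.mk₀_bijective _ _).2 v
  dsimp at v hv
  rw [Ext.mk₀_comp_mk₀] at hv
  replace hv : v ≫ q = u + -𝟙 Q := (Ext.mk₀_bijective _ _).1 hv
  obtain ⟨w, hw⟩ := thickAux_square hab hS hiq hT p (e - b ≫ v)
    (by rw [Preadditive.comp_sub, reassoc_of% hab, zero_comp, sub_zero, he])
    (by rw [Preadditive.sub_comp, Category.assoc, hv, Preadditive.comp_add, hu]; simp)
  exact ⟨E, _, _, w, hw⟩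

theorem thick_subcategory_of_hereditary_is_wide
    {C : Type u} [Category.{v} C] [Abelian C] [HasExt.{w} C]
    -- `C` is hereditary: Ext^n vanishes for all n ≥ 2
    (hered : ∀ (X Y : C) (n : ℕ), 2 ≤ n → Subsingleton (Ext X Y n))
    (P : C → Prop)
    -- `P` is closed under direct summands
    (hsum : ∀ {X Y : C} (i : X ⟶ Y) (r : Y ⟶ X), i ≫ r = 𝟙 X → P Y → P X)
    -- `P` satisfies the 2-of-3 condition for short exact sequences
    (h23 : ∀ (S : ShortComplex C), S.ShortExact →
      ((P S.X₁ ∧ P S.X₂ → P S.X₃) ∧ (P S.X₁ ∧ P S.X₃ → P S.X₂) ∧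
        (P S.X₂ ∧ P S.X₃ → P S.X₁))) :
    -- then `P` is wide: closed under kernels, cokernels, and extensions
    (∀ {X Y : C} (f : X ⟶ Y), P X → P Y → P (kernel f)) ∧
    (∀ {X Y : C} (f : X ⟶ Y), P X → P Y → P (cokernel f)) ∧
    (∀ (S : ShortComplex C), S.ShortExact → P S.X₁ → P S.X₃ → P S.X₂) := by
  have himg : ∀ {X Y : C} (f : X ⟶ Y), P X → P Y → P (kernel f) ∧ P (cokernel f) := by
    intro X Y f hX hY
    have hkp : kernel.ι f ≫ Abelian.factorThruImage f = 0 := by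
      rw [← cancel_mono (Abelian.image.ι f)]; simp
    have hU : (ShortComplex.mk (kernel.ι f) (Abelian.factorThruImage f) hkp).ShortExact :=
      { exact := by
          apply ShortComplex.exact_of_f_is_kernel
          refine KernelFork.IsLimit.ofι' _ _ (fun {A} t ht => ⟨kernel.lift f t ?_, kernel.lift_ι f t _⟩)
          dsimp at t ht
          have h3 := ht =≫ Abelian.image.ι f
          rwa [Category.assoc, Abelian.image.fac f, zero_comp] at h3 }
    have hiq : Abelian.image.ι f ≫ cokernel.π f = 0 := kernel.condition _
    have hT : (ShortComplex.mk (Abelian.image.ι f) (cokernel.π f) hiq).ShortExact :=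
      { exact := ShortComplex.exact_kernel (cokernel.π f) }
    obtain ⟨E, a, b, hw, hE⟩ := thickAux_key (hered _ _ 2 le_rfl) hkp hU hiq hT
    have hEI := (h23 _ hE).2.1 ⟨hX, hY⟩
    have hI : P (Abelian.image f) := hsum biprod.inr biprod.snd (by simp) hEI
    exact ⟨(h23 _ hU).2.2 ⟨hX, hI⟩, (h23 _ hT).1 ⟨hI, hY⟩⟩
  exact ⟨fun f hX hY => (himg f hX hY).1, fun f hX hY => (himg f hX hY).2,
    fun S hS h1 h3 => (h23 S hS).2.1 ⟨h1, h3⟩⟩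
end

section
/- Let T be a k-linear triangulated category classically generated by a family of objects {t_i}_{i∈I} satisfying: Hom(t_i, t_i) = k, Hom(t_i, t_j) = 0 for i ≠ j, and Hom^p(t_i, t_j) = 0 for all i,j and p ∉ {0,1} (a vertex-like family). Then the classes [t_i] freely generate the Grothendieck group: K_0(T) ≅ ⊕_{i∈I} Z·[t_i]. -/
/-!
STATEMENT 16: Let `T` be a `k`-linear triangulated category classically generated by
a vertex-like family `{t_i}_{i ∈ I}`: `Hom(t_i, t_i) = k`, `Hom(t_i, t_j) = 0` for
`i ≠ j`, and `Hom^p(t_i, t_j) = 0` for `p ∉ {0, 1}`.  Then the classes `[t_i]`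
freely generate the Grothendieck group: `K₀(T) ≅ ⊕_{i ∈ I} ℤ·[t_i]`.

`K₀` is defined as the free abelian group on the objects modulo the relations from
distinguished triangles; the conclusion asserts that the natural homomorphism
`⊕_{i ∈ I} ℤ → K₀(T)` sending the `i`-th basis vector to `[t_i]` is bijective.
-/

open CategoryTheory Limits Pretriangulated

noncomputable section

universe v u

variable (D : Type u) [Category.{v} D] [Preadditive D] [HasZeroObject D]
  [HasShift D ℤ] [∀ n : ℤ, (shiftFunctor D n).Additive] [Pretriangulated D]

/-- The subgroup of relations defining `K₀` of a triangulated category. -/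
def triangleRelations : AddSubgroup (FreeAbelianGroup D) :=
  AddSubgroup.closure {x | ∃ T ∈ distTriang D,
    x = FreeAbelianGroup.of T.obj₂ - FreeAbelianGroup.of T.obj₁ -
      FreeAbelianGroup.of T.obj₃}

/-- The Grothendieck group of a triangulated category. -/
def K0 := FreeAbelianGroup D ⧸ triangleRelations D

instance : AddCommGroup (K0 D) := QuotientAddGroup.Quotient.addCommGroup _

/-- The class of an object in `K₀`. -/
def K0.cls (X : D) : K0 D := QuotientAddGroup.mk (FreeAbelianGroup.of X)

namespace VL

section Aux

set_option linter.unusedSectionVars false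
set_option linter.unusedVariables false

variable {D} {I : Type} (t : I → D)

/-- Iterated fibres of nonzero maps to objects `t i⟦1⟧`. -/
inductive VExt (C : D) : ∀ {C' : D}, (C' ⟶ C) → Prop
  | refl : VExt C (𝟙 C)
  | step {C'' C' : D} {i : I} (f : C' ⟶ C) (a : t i ⟶ C'') (p : C'' ⟶ C')
      (g : C' ⟶ (t i)⟦(1 : ℤ)⟧) (hT : Triangle.mk a p g ∈ distTriang D) (hg : g ≠ 0)
      (hf : VExt C f) : VExt C (p ≫ f)

variable {t} in
lemma VExt.comp {C C' C'' : D} {f : C' ⟶ C} {g : C'' ⟶ C'} (hg : VExt t C' g)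
    (hf : VExt t C f) : VExt t C (g ≫ f) := by
  induction hg with
  | refl => simpa using hf
  | step f' a p q hT hq _ ih =>
    rw [Category.assoc]
    exact VExt.step _ a p q hT hq ih

/-- Subfunctors of the functor represented by `Y`. -/
structure Idl (Y : D) where
  /-- the underlying family of subgroups -/
  car : ∀ Z : D, AddSubgroup (Z ⟶ Y)
  closed : ∀ {Z Z' : D} (f : Z' ⟶ Z) (u : Z ⟶ Y), u ∈ car Z → f ≫ u ∈ car Z'

namespace Idl

/-- inclusion -/
def le {Y : D} (N M : Idl Y) : Prop := ∀ Z (u : Z ⟶ Y), u ∈ N.car Z → u ∈ M.car Z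

/-- intersection -/
def inf {Y : D} (N M : Idl Y) : Idl Y where
  car Z := N.car Z ⊓ M.car Z
  closed f u h := ⟨N.closed f u h.1, M.closed f u h.2⟩

/-- sum -/
def sup {Y : D} (N M : Idl Y) : Idl Y where
  car Z := N.car Z ⊔ M.car Z
  closed f u h := by
    rw [AddSubgroup.mem_sup] at h ⊢
    obtain ⟨y, hy, z, hz, rfl⟩ := h
    exact ⟨f ≫ y, N.closed f y hy, f ≫ z, M.closed f z hz, by simp⟩

/-- the zero subfunctor -/
def bot (Y : D) : Idl Y where
  car Z := ⊥
  closed f u h := by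
    rw [AddSubgroup.mem_bot] at h ⊢
    simp [h]

/-- the whole functor -/
def top (Y : D) : Idl Y where
  car Z := ⊤
  closed f u h := AddSubgroup.mem_top _

/-- the kernel of the map induced by `f` -/
def ker {X Y : D} (f : X ⟶ Y) : Idl X where
  car Z :=
    { carrier := {u | u ≫ f = 0}
      zero_mem' := by simp
      add_mem' := by
        intro a b ha hb
        simp only [Set.mem_ofPred_eq] at *
        simp [ha, hb]
      neg_mem' := by
        intro a ha
        simp only [Set.mem_ofPred_eq] at *
        simp [ha] }
  closed e u h := by
    change (e ≫ u) ≫ f = 0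
    have h' : u ≫ f = 0 := h
    simp [h']

lemma mem_ker {X Y Z : D} (f : X ⟶ Y) (u : Z ⟶ X) : u ∈ (ker f).car Z ↔ u ≫ f = 0 := Iff.rfl

/-- direct image -/
def map {X Y : D} (f : X ⟶ Y) (N : Idl X) : Idl Y where
  car Z :=
    { carrier := {u | ∃ v ∈ N.car Z, v ≫ f = u}
      zero_mem' := ⟨0, zero_mem _, by simp⟩
      add_mem' := by
        rintro _ _ ⟨a, ha, rfl⟩ ⟨b, hb, rfl⟩
        exact ⟨a + b, add_mem ha hb, by simp⟩
      neg_mem' := by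
        rintro _ ⟨a, ha, rfl⟩
        exact ⟨-a, neg_mem ha, by simp⟩ }
  closed := by
    rintro _ _ e _ ⟨v, hv, rfl⟩
    exact ⟨e ≫ v, N.closed e v hv, by simp⟩

lemma mem_map {X Y Z : D} (f : X ⟶ Y) (N : Idl X) (u : Z ⟶ Y) :
    u ∈ (map f N).car Z ↔ ∃ v ∈ N.car Z, v ≫ f = u := Iff.rfl

/-- inverse image -/
def comap {X Y : D} (f : X ⟶ Y) (N : Idl Y) : Idl X where
  car Z :=
    { carrier := {u | u ≫ f ∈ N.car Z}
      zero_mem' := by simp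
      add_mem' := by
        intro a b ha hb
        simp only [Set.mem_ofPred_eq] at *
        simpa using add_mem ha hb
      neg_mem' := by
        intro a ha
        simp only [Set.mem_ofPred_eq] at *
        simpa using ha }
  closed := by
    intro _ _ e u hu
    change (e ≫ u) ≫ f ∈ N.car _
    rw [Category.assoc]
    exact N.closed e _ hu

lemma mem_comap {X Y Z : D} (f : X ⟶ Y) (N : Idl Y) (u : Z ⟶ X) :
    u ∈ (comap f N).car Z ↔ u ≫ f ∈ N.car Z := Iff.rfl

end Idl

variable (j : I)

/-- `M` is contained in `N` up to passing to extensions of towers over `t j`. -/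
def Sm {Y : D} (N M : Idl Y) : Prop :=
  ∀ (C : D) (π : C ⟶ t j), VExt t (t j) π → ∀ u ∈ M.car C,
    ∃ (E : D) (f : E ⟶ C), VExt t C f ∧ f ≫ u ∈ N.car E

/-- Chains with non-small steps. -/
inductive Ch {Y : D} (a : Idl Y) : Idl Y → ℕ → Prop
  | base {b : Idl Y} (h : a.le b) : Ch a b 0
  | step {b c : Idl Y} {n : ℕ} (h : Ch a b n) (hbc : b.le c) (hs : ¬ Sm t j b c) : Ch a c (n + 1)

variable {t j}

lemma Sm.of_le {Y : D} {N M : Idl Y} (h : M.le N) : Sm t j N M := fun C π _ u hu =>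
  ⟨C, 𝟙 C, VExt.refl, by simpa using h _ _ hu⟩

lemma Sm.mono {Y : D} {N M N' M' : Idl Y} (h : Sm t j N M) (hN : N.le N') (hM : M'.le M) :
    Sm t j N' M' := fun C π hπ u hu => by
  obtain ⟨C', f, hf, hu'⟩ := h C π hπ u (hM _ _ hu)
  exact ⟨C', f, hf, hN _ _ hu'⟩

lemma Sm.glue {Y : D} {x y : Idl Y} (b : Idl Y) (hxy : x.le y)
    (h1 : Sm t j (x.inf b) (y.inf b)) (h2 : Sm t j (x.sup b) (y.sup b)) : Sm t j x y := by
  intro C π hπ u hu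
  obtain ⟨C', f, hf, hu'⟩ := h2 C π hπ u (AddSubgroup.mem_sup_left hu)
  obtain ⟨v, hv, w, hw, hvw⟩ := AddSubgroup.mem_sup.1 hu'
  have hw' : w ∈ (y.inf b).car C' := by
    refine ⟨?_, hw⟩
    change w ∈ y.car C'
    have : w = f ≫ u - v := by rw [← hvw]; abel
    rw [this]
    exact sub_mem (y.closed _ _ hu) (hxy _ _ hv)
  obtain ⟨C'', f', hf', hw''⟩ := h1 C' (f ≫ π) (hf.comp hπ) w hw'
  refine ⟨C'', f' ≫ f, hf'.comp hf, ?_⟩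
  rw [Category.assoc, ← hvw, Preadditive.comp_add]
  exact add_mem (x.closed _ _ hv) hw''.1

lemma Ch.le {Y : D} {a b : Idl Y} {n : ℕ} (h : Ch t j a b n) : a.le b := by
  induction h with
  | base h => exact h
  | step _ hbc _ ih => exact fun Z u hu => hbc _ _ (ih _ _ hu)

lemma Ch.mono_right {Y : D} {a b b' : Idl Y} {n : ℕ} (h : Ch t j a b n) (hb : b.le b') :
    Ch t j a b' n := by
  cases h with
  | base h => exact Ch.base fun Z u hu => hb _ _ (h _ _ hu)
  | step h hbc hs =>
    exact Ch.step h (fun Z u hu => hb _ _ (hbc _ _ hu))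
      (fun h' => hs (h'.mono (fun _ _ h => h) hb))

lemma Ch.mono_left {Y : D} {a a' b : Idl Y} {n : ℕ} (h : Ch t j a b n) (ha : a'.le a) :
    Ch t j a' b n := by
  induction h with
  | base h => exact Ch.base fun Z u hu => h _ _ (ha _ _ hu)
  | step _ hbc hs ih => exact Ch.step ih hbc hs

lemma Ch.trans {Y : D} {a b c : Idl Y} {n m : ℕ} (h : Ch t j a b n) (h' : Ch t j b c m) :
    Ch t j a c (n + m) := by
  induction h' with
  | base h' => exact h.mono_right h'
  | step _ hbc hs ih => exact Ch.step ih hbc hs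

lemma Idl.inf_le_inf {Y : D} {a b : Idl Y} (c : Idl Y) (h : a.le b) : (a.inf c).le (b.inf c) :=
  fun _ _ hu => ⟨h _ _ hu.1, hu.2⟩

lemma Idl.sup_le_sup {Y : D} {a b : Idl Y} (c : Idl Y) (h : a.le b) : (a.sup c).le (b.sup c) :=
  fun Z _ hu => (_root_.sup_le_sup_right (show a.car Z ≤ b.car Z from fun x hx => h _ _ hx) _) hu

lemma Ch.split {Y : D} {a c : Idl Y} {n : ℕ} (h : Ch t j a c n) (b : Idl Y) :
    ∃ n1 n2, n ≤ n1 + n2 ∧ Ch t j (a.inf b) (c.inf b) n1 ∧ Ch t j (a.sup b) (c.sup b) n2 := by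
  induction h with
  | base h => exact ⟨0, 0, by simp, Ch.base (Idl.inf_le_inf b h), Ch.base (Idl.sup_le_sup b h)⟩
  | @step x y n h hbc hs ih =>
    obtain ⟨n1, n2, hn, h1, h2⟩ := ih
    by_cases hh : Sm t j (x.inf b) (y.inf b)
    · by_cases hh' : Sm t j (x.sup b) (y.sup b)
      · exact (hs (Sm.glue b hbc hh hh')).elim
      · exact ⟨n1, n2 + 1, by omega, h1.mono_right (Idl.inf_le_inf b hbc),
          Ch.step h2 (Idl.sup_le_sup b hbc) hh'⟩
    · exact ⟨n1 + 1, n2, by omega, Ch.step h1 (Idl.inf_le_inf b hbc) hh,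
        h2.mono_right (Idl.sup_le_sup b hbc)⟩

variable (t j)

/-- relative length -/
def len {Y : D} (a b : Idl Y) : ℕ∞ := ⨆ n : {n : ℕ // Ch t j a b n}, ((n : ℕ) : ℕ∞)

variable {t j}

lemma le_len {Y : D} {a b : Idl Y} {n : ℕ} (h : Ch t j a b n) : (n : ℕ∞) ≤ len t j a b :=
  le_iSup (fun n : {n : ℕ // Ch t j a b n} => ((n : ℕ) : ℕ∞)) ⟨n, h⟩

lemma len_le {Y : D} {a b : Idl Y} {c : ℕ∞} (h : ∀ n : ℕ, Ch t j a b n → (n : ℕ∞) ≤ c) :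
    len t j a b ≤ c := iSup_le fun n => h n.1 n.2

lemma len_mono {Y : D} {a b a' b' : Idl Y} (ha : a'.le a) (hb : b.le b') :
    len t j a b ≤ len t j a' b' :=
  len_le fun _ hn => le_len ((hn.mono_left ha).mono_right hb)

lemma len_add {Y : D} {a b c : Idl Y} (hab : a.le b) (hbc : b.le c) :
    len t j a c = len t j a b + len t j b c := by
  apply le_antisymm
  · refine len_le fun n hn => ?_
    obtain ⟨n1, n2, h, h1, h2⟩ := hn.split b
    have h1' : Ch t j a b n1 := (h1.mono_left fun _ _ hu => ⟨hu, hab _ _ hu⟩).mono_right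
      fun _ _ hu => hu.2
    have h2' : Ch t j b c n2 := (h2.mono_left fun _ _ hu => AddSubgroup.mem_sup_right hu).mono_right
      fun Z _ hu => (sup_le (show c.car Z ≤ c.car Z from le_rfl)
        (show b.car Z ≤ c.car Z from fun x hx => hbc _ _ hx)) hu
    calc (n : ℕ∞) ≤ ((n1 + n2 : ℕ) : ℕ∞) := by exact_mod_cast h
      _ = n1 + n2 := by push_cast; rfl
      _ ≤ _ := add_le_add (le_len h1') (le_len h2')
  · have : Nonempty {n : ℕ // Ch t j a b n} := ⟨⟨0, Ch.base hab⟩⟩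
    have : Nonempty {n : ℕ // Ch t j b c n} := ⟨⟨0, Ch.base hbc⟩⟩
    refine ENat.iSup_add_iSup_le fun n m => ?_
    have := le_len (n.2.trans m.2)
    push_cast at this
    exact this

variable (t j)

/-- length of an object -/
def rho (X : D) : ℕ∞ := len t j (Idl.bot X) (Idl.top X)

/-- length of the image of a morphism -/
def iota {X Y : D} (f : X ⟶ Y) : ℕ∞ := len t j (Idl.ker f) (Idl.top X)

variable {t j}

lemma bot_le {X : D} (a : Idl X) : (Idl.bot X).le a := fun Z u hu => by
  rw [(AddSubgroup.mem_bot.1 hu : u = 0)]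
  exact zero_mem _

lemma le_top {X : D} (a : Idl X) : a.le (Idl.top X) := fun _ _ _ => AddSubgroup.mem_top _

lemma Ch.map {X Y : D} (f : X ⟶ Y) {a b : Idl X} {n : ℕ} (h : Ch t j a b n)
    (ha : (Idl.ker f).le a) : Ch t j (a.map f) (b.map f) n := by
  have key : ∀ {x y : Idl X}, x.le y → (x.map f).le (y.map f) := by
    rintro x y h Z _ ⟨v, hv, rfl⟩
    exact ⟨v, h _ _ hv, rfl⟩
  induction h with
  | base h => exact Ch.base (key h)
  | @step x y n h hbc hs ih =>
    refine Ch.step ih (key hbc) fun hsm => hs ?_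
    intro C π hπ u hu
    obtain ⟨C', e, he, v, hv, hve⟩ := hsm C π hπ (u ≫ f) ⟨u, hu, rfl⟩
    refine ⟨C', e, he, ?_⟩
    have h1 : e ≫ u - v ∈ (Idl.ker f).car C' := by
      rw [Idl.mem_ker, Preadditive.sub_comp, hve]
      simp
    have := add_mem (h.le _ _ (ha _ _ h1)) hv
    simpa using this

lemma Ch.comap {X Y : D} (f : X ⟶ Y) {a b : Idl Y} {n : ℕ} (h : Ch t j a b n)
    (hb : b.le ((Idl.top X).map f)) : Ch t j (a.comap f) (b.comap f) n := by
  have key : ∀ {x y : Idl Y}, x.le y → (x.comap f).le (y.comap f) := by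
    rintro x y h Z u hu
    exact h _ _ hu
  induction h with
  | base h => exact Ch.base (key h)
  | @step x y n h hbc hs ih =>
    refine Ch.step (ih fun Z u hu => hb _ _ (hbc _ _ hu)) (key hbc) fun hsm => hs ?_
    intro C π hπ u hu
    obtain ⟨v, -, rfl⟩ := hb _ _ hu
    obtain ⟨C', e, he, hv⟩ := hsm C π hπ v hu
    refine ⟨C', e, he, ?_⟩
    rw [Idl.mem_comap, Category.assoc] at hv
    exact hv

lemma iota_eq {X Y : D} (f : X ⟶ Y) :
    iota t j f = len t j (Idl.bot Y) ((Idl.top X).map f) := by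
  apply le_antisymm
  · refine len_le fun n hn => ?_
    exact le_len ((hn.map f fun _ _ h => h).mono_left (bot_le _))
  · refine len_le fun n hn => ?_
    refine le_len (((hn.comap f fun _ _ h => h).mono_left ?_).mono_right (le_top _))
    intro Z u hu
    rw [Idl.mem_comap, (Idl.mem_ker _ _).1 hu]
    exact zero_mem _

lemma iota_le_source {X Y : D} (f : X ⟶ Y) : iota t j f ≤ rho t j X :=
  len_mono (bot_le _) (fun _ _ h => h)

lemma iota_le_target {X Y : D} (f : X ⟶ Y) : iota t j f ≤ rho t j Y := by
  rw [iota_eq]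
  exact len_mono (fun _ _ h => h) (le_top _)

lemma rho_le_of_retract {X Y : D} (s : X ⟶ Y) (r : Y ⟶ X) (h : s ≫ r = 𝟙 X) :
    rho t j X ≤ rho t j Y := by
  refine le_trans (len_mono ?_ (fun _ _ h => h)) (iota_le_target s)
  intro Z u hu
  have hu' : u ≫ s = 0 := hu
  apply AddSubgroup.mem_bot.2
  rw [← Category.comp_id u, ← h, ← Category.assoc, hu', zero_comp]

lemma rho_iso {X Y : D} (e : X ≅ Y) : rho t j X = rho t j Y :=
  le_antisymm (rho_le_of_retract e.hom e.inv (by simp)) (rho_le_of_retract e.inv e.hom (by simp))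

/-- exactness at the middle -/
def Ex {X Y Z : D} (f : X ⟶ Y) (g : Y ⟶ Z) : Prop :=
  f ≫ g = 0 ∧ ∀ (W : D) (u : W ⟶ Y), u ≫ g = 0 → ∃ v, v ≫ f = u

lemma Ex.rho {X Y Z : D} {f : X ⟶ Y} {g : Y ⟶ Z} (h : Ex f g) :
    rho t j Y = iota t j f + iota t j g := by
  rw [iota_eq f, VL.rho, len_add (bot_le ((Idl.top X).map f)) (le_top _)]
  congr 1
  apply le_antisymm
  · refine len_mono ?_ (fun _ _ h => h)
    intro W u hu
    obtain ⟨v, rfl⟩ := h.2 W u hu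
    exact ⟨v, AddSubgroup.mem_top _, rfl⟩
  · refine len_mono ?_ (fun _ _ h => h)
    rintro W _ ⟨v, -, rfl⟩
    rw [Idl.mem_ker, Category.assoc, h.1, comp_zero]

lemma iota_comp_iso {X Y Y' : D} (f : X ⟶ Y) (e : Y ⟶ Y') [IsIso e] :
    iota t j (f ≫ e) = iota t j f := by
  apply le_antisymm <;> refine len_mono ?_ (fun _ _ h => h)
  · intro Z u hu
    rw [Idl.mem_ker] at hu ⊢
    simp [← Category.assoc, hu]
  · intro Z u hu
    rw [Idl.mem_ker] at hu ⊢
    rw [← cancel_mono e, Category.assoc, hu, zero_comp]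

lemma iota_iso_comp {X X' Y : D} (e : X' ⟶ X) [IsIso e] (f : X ⟶ Y) :
    iota t j (e ≫ f) = iota t j f := by
  rw [iota_eq, iota_eq]
  apply le_antisymm <;> refine len_mono (fun _ _ h => h) ?_
  · rintro Z _ ⟨v, -, rfl⟩
    exact ⟨v ≫ e, AddSubgroup.mem_top _, by simp⟩
  · rintro Z _ ⟨v, -, rfl⟩
    exact ⟨v ≫ inv e, AddSubgroup.mem_top _, by simp⟩

lemma iota_neg {X Y : D} (f : X ⟶ Y) : iota t j (-f) = iota t j f := by
  apply le_antisymm <;> refine len_mono ?_ (fun _ _ h => h)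
  · intro Z u hu
    rw [Idl.mem_ker] at hu ⊢
    simp [hu]
  · intro Z u hu
    rw [Idl.mem_ker] at hu ⊢
    simpa using hu

lemma iota_shift_shift {X Y : D} (f : X ⟶ Y) (a b c : ℤ) (h : a + b = c) :
    iota t j (f⟦a⟧'⟦b⟧') = iota t j (f⟦c⟧') := by
  have := (shiftFunctorAdd' D a b c h).hom.naturality f
  rw [← iota_comp_iso (f⟦c⟧') ((shiftFunctorAdd' D a b c h).hom.app Y), this, iota_iso_comp]
  rfl

lemma iota_shift_zero {X Y : D} (f : X ⟶ Y) : iota t j (f⟦(0 : ℤ)⟧') = iota t j f := by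
  have := (shiftFunctorZero D ℤ).hom.naturality f
  rw [← iota_comp_iso (f⟦(0 : ℤ)⟧') ((shiftFunctorZero D ℤ).hom.app Y), this, iota_iso_comp]
  rfl

lemma Ex.of_units {X Y Z : D} {f : X ⟶ Y} {g : Y ⟶ Z} (e : ℤˣ) (h : Ex (e • f) (e • g)) :
    Ex f g := by
  rcases Int.units_eq_one_or e with rfl | rfl
  · simpa using h
  · obtain ⟨h1, h2⟩ := h
    refine ⟨by simpa using h1, fun W u hu => ?_⟩
    obtain ⟨v, hv⟩ := h2 W u (by simpa using hu)
    exact ⟨-v, by simpa using hv⟩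

lemma ex12 (T : Triangle D) (hT : T ∈ distTriang D) (p : ℤ) :
    Ex (T.mor₁⟦p⟧') (T.mor₂⟦p⟧') := by
  have h := Triangle.shift_distinguished T hT p
  apply Ex.of_units p.negOnePow
  refine ⟨comp_distTriang_mor_zero₁₂ _ h, fun W u hu => ?_⟩
  obtain ⟨v, hv⟩ := Triangle.coyoneda_exact₂ _ h u hu
  exact ⟨v, hv.symm⟩

lemma tri_rho (T : Triangle D) (hT : T ∈ distTriang D) (p : ℤ) :
    rho t j (T.obj₂⟦p⟧) = iota t j (T.mor₁⟦p⟧') + iota t j (T.mor₂⟦p⟧') ∧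
    rho t j (T.obj₃⟦p⟧) = iota t j (T.mor₂⟦p⟧') + iota t j (T.mor₃⟦p⟧') ∧
    rho t j (T.obj₁⟦p + 1⟧) = iota t j (T.mor₃⟦p⟧') + iota t j (T.mor₁⟦p + 1⟧') := by
  refine ⟨(ex12 T hT p).rho, (ex12 _ (rot_of_distTriang _ hT) p).rho, ?_⟩
  have h := (ex12 _ (rot_of_distTriang _ (rot_of_distTriang _ hT)) p).rho (t := t) (j := j)
  have e : T.obj₁⟦p + 1⟧ ≅ T.obj₁⟦(1 : ℤ)⟧⟦p⟧ :=
    (shiftFunctorAdd' D 1 p (p + 1) (by ring)).app T.obj₁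
  rw [rho_iso e]
  refine h.trans ?_
  congr 1
  have h2 : iota t j ((-(T.mor₁⟦(1 : ℤ)⟧'))⟦p⟧') = iota t j (T.mor₁⟦p + 1⟧') := by
    rw [Functor.map_neg, iota_neg, iota_shift_shift _ 1 p (p + 1) (by ring)]
  exact h2


lemma yon2 {X Y Z W : D} {a : X ⟶ Y} {p : Y ⟶ Z} {g : Z ⟶ X⟦(1 : ℤ)⟧}
    (hT : Triangle.mk a p g ∈ distTriang D) (u : Y ⟶ W) (h : a ≫ u = 0) :
    ∃ v : Z ⟶ W, u = p ≫ v := Triangle.yoneda_exact₂ _ hT u h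

lemma yon3 {X Y Z W : D} {a : X ⟶ Y} {p : Y ⟶ Z} {g : Z ⟶ X⟦(1 : ℤ)⟧}
    (hT : Triangle.mk a p g ∈ distTriang D) (u : Z ⟶ W) (h : p ≫ u = 0) :
    ∃ v : X⟦(1 : ℤ)⟧ ⟶ W, u = g ≫ v := Triangle.yoneda_exact₃ _ hT u h

lemma coy3 {X Y Z W : D} {a : X ⟶ Y} {p : Y ⟶ Z} {g : Z ⟶ X⟦(1 : ℤ)⟧}
    (hT : Triangle.mk a p g ∈ distTriang D) (u : W ⟶ Z) (h : u ≫ g = 0) :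
    ∃ v : W ⟶ Y, u = v ≫ p := Triangle.coyoneda_exact₃ _ hT u h

lemma hom_shift_zero (m : ℤ) {Z Y : D} (h : ∀ u : Z ⟶ Y⟦-m⟧, u = 0) (f : Z⟦m⟧ ⟶ Y) : f = 0 := by
  apply (shiftFunctor D (-m)).map_injective
  rw [Functor.map_zero]
  have := h ((shiftFunctorCompIsoId D m (-m) (by ring)).inv.app Z ≫ f⟦-m⟧')
  exact (Preadditive.IsIso.comp_left_eq_zero _ _).1 this

lemma hom_iso_zero {Z Y Y' : D} (e : Y ≅ Y') (h : ∀ u : Z ⟶ Y, u = 0) (f : Z ⟶ Y') : f = 0 := by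
  rw [← cancel_mono e.inv, h (f ≫ e.inv), zero_comp]

/-- shift composition -/
def shiftShift (X : D) (a b c : ℤ) (h : a + b = c) : X⟦a⟧⟦b⟧ ≅ X⟦c⟧ :=
  ((shiftFunctorAdd' D a b c h).app X).symm

/-- The hypotheses on the family. -/
structure VLike (k : Type) [Field k] [Linear k D] (t : I → D) : Prop where
  hend : ∀ i, Function.Bijective (algebraMap k (End (t i)))
  hhom : ∀ i j, i ≠ j → ∀ f : t i ⟶ t j, f = 0
  hshift : ∀ i j (p : ℤ), p ≠ 0 → p ≠ 1 → ∀ f : t i ⟶ (t j)⟦p⟧, f = 0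

section Tower

variable {k : Type} [Field k] [Linear k D] 


lemma VLike.smul_id (H : VLike k t) (i : I) (f : t i ⟶ t i) : ∃ c : k, f = c • 𝟙 (t i) := by
  obtain ⟨c, hc⟩ := (H.hend i).2 f
  refine ⟨c, ?_⟩
  rw [← hc, Algebra.algebraMap_eq_smul_one]
  rfl

lemma VLike.id_ne (H : VLike k t) (i : I) : 𝟙 (t i) ≠ 0 := by
  intro h
  have : (algebraMap k (End (t i))) 1 = (algebraMap k (End (t i))) 0 := by
    rw [map_one, map_zero]
    exact h
  exact one_ne_zero ((H.hend i).1 this)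

lemma VLike.inv (H : VLike k t) {C : D} {π : C ⟶ t j} (h : VExt t (t j) π) :
    (∀ l (p : ℤ), p ≠ 0 → p ≠ 1 → ∀ u : C ⟶ (t l)⟦p⟧, u = 0) ∧
    (∀ l, l ≠ j → ∀ u : C ⟶ t l, u = 0) ∧ (∀ u : C ⟶ t j, ∃ c : k, u = c • π) ∧ π ≠ 0 := by
  induction h with
  | refl =>
    exact ⟨fun l => H.hshift j l, fun l hl => H.hhom j l hl.symm, H.smul_id j, H.id_ne j⟩
  | @step C'' C' i f a p g hT hg hf ih =>
    obtain ⟨h1, h2, h3, h4⟩ := ih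
    have key : ∀ l (u : C'' ⟶ t l), ∃ v : C' ⟶ t l, u = p ≫ v := by
      intro l u
      have h0 : a ≫ u = 0 := by
        by_cases hil : i = l
        · subst hil
          obtain ⟨c, hc⟩ := H.smul_id i (a ≫ u)
          by_cases hc0 : c = 0
          · rw [hc, hc0, zero_smul]
          · exfalso
            apply hg
            have h5 : a ≫ (c⁻¹ • u) = 𝟙 _ := by
              rw [Linear.comp_smul, hc, smul_smul, inv_mul_cancel₀ hc0, one_smul]
            have : SplitMono a := ⟨c⁻¹ • u, h5⟩
            exact Triangle.mor₃_eq_zero_of_mono₁ _ hT this.mono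
        · exact H.hhom i l hil _
      obtain ⟨v, hv⟩ := yon2 hT u h0
      exact ⟨v, hv⟩
    refine ⟨?_, ?_, ?_, ?_⟩
    · intro l q hq0 hq1 u
      obtain ⟨v, hv⟩ := yon2 hT u (H.hshift i l q hq0 hq1 _)
      rw [hv, h1 l q hq0 hq1 v, comp_zero]
    · intro l hl u
      obtain ⟨v, hv⟩ := key l u
      rw [hv, h2 l hl v, comp_zero]
    · intro u
      obtain ⟨v, hv⟩ := key j u
      obtain ⟨c, hc⟩ := h3 v
      exact ⟨c, by rw [hv, hc, Linear.comp_smul]⟩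
    · intro h0
      apply h4
      obtain ⟨w, hw⟩ := yon3 hT f h0
      have : w = 0 := hom_shift_zero 1 (H.hshift i j (-1) (by norm_num) (by norm_num)) w
      rw [hw, this, comp_zero]

lemma VLike.kill (H : VLike k t) {C : D} {π : C ⟶ t j} (h : VExt t (t j) π) (i : I) (p : ℤ)
    (hip : ¬ (i = j ∧ p = 0)) (u : C ⟶ (t i)⟦p⟧) :
    ∃ (C' : D) (f : C' ⟶ C), VExt t C f ∧ f ≫ u = 0 := by
  obtain ⟨h1, h2, -, -⟩ := H.inv h
  by_cases hu : u = 0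
  · exact ⟨C, 𝟙 C, VExt.refl, by simp [hu]⟩
  by_cases hp0 : p = 0
  · subst hp0
    exact (hu (hom_iso_zero ((shiftFunctorZero D ℤ).app (t i)).symm
      (h2 i (fun h => hip ⟨h, rfl⟩)) u)).elim
  by_cases hp1 : p = 1
  · subst hp1
    obtain ⟨C', a, q, hT⟩ := distinguished_cocone_triangle₂ u
    refine ⟨C', q ≫ 𝟙 C, VExt.step _ a q u hT hu VExt.refl, ?_⟩
    rw [Category.comp_id]
    exact comp_distTriang_mor_zero₂₃ _ hT
  · exact (hu (h1 i p hp0 hp1 u)).elim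

lemma VLike.dom (H : VLike k t) {C₁ C₂ : D} {π₁ : C₁ ⟶ t j} {π₂ : C₂ ⟶ t j} (h₁ : VExt t (t j) π₁)
    (h₂ : VExt t (t j) π₂) :
    ∃ (C' : D) (f : C' ⟶ C₂) (m : C' ⟶ C₁), VExt t C₂ f ∧ f ≫ π₂ = m ≫ π₁ := by
  induction h₁ with
  | refl => exact ⟨C₂, 𝟙 _, π₂, VExt.refl, by simp⟩
  | @step C'' C' i f a p g hT hg hf ih =>
    obtain ⟨E, e, m, he, hem⟩ := ih
    obtain ⟨E', e', he', h0⟩ := H.kill (he.comp h₂) i 1 (by simp) (m ≫ g)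
    obtain ⟨v, hv⟩ := coy3 hT (e' ≫ m) (by simpa using h0)
    refine ⟨E', e' ≫ e, v, he'.comp he, ?_⟩
    rw [Category.assoc, hem, ← Category.assoc, hv, Category.assoc]

lemma VLike.simple (H : VLike k t) (M c : Idl (t j)) (h : ¬ Sm t j (Idl.bot _) M) : Sm t j M c := by
  unfold Sm at h
  push Not at h
  obtain ⟨C, π, hπ, u, hu, hk⟩ := h
  have hu0 : u ≠ 0 := fun h0 => hk C (𝟙 C) VExt.refl (by
    rw [h0, comp_zero]; exact zero_mem _)
  obtain ⟨-, -, h3, -⟩ := H.inv hπ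
  obtain ⟨x, hx⟩ := h3 u
  have hx0 : x ≠ 0 := by
    rintro rfl
    exact hu0 (by simp [hx])
  have hπM : π ∈ M.car C := by
    have := M.closed (x⁻¹ • 𝟙 C) u hu
    rwa [hx, Linear.smul_comp, Category.id_comp, smul_smul, inv_mul_cancel₀ hx0, one_smul] at this
  intro C₂ π₂ hπ₂ v _
  obtain ⟨y, rfl⟩ := (H.inv hπ₂).2.2.1 v
  obtain ⟨C', f, m, hf, hfm⟩ := H.dom hπ hπ₂
  refine ⟨C', f, hf, ?_⟩
  have := M.closed (y • m) π hπM
  rwa [Linear.smul_comp, ← hfm, ← Linear.comp_smul] at this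

lemma VLike.not_sm (H : VLike k t) {X : D} (i : I) (g : t i ⟶ X) (hg : g ≠ 0)
    (hX : ∀ l (u : (t l)⟦(1 : ℤ)⟧ ⟶ X), u = 0) :
    ¬ Sm t i (Idl.ker g) (Idl.top _) := by
  intro h
  obtain ⟨C, f, hf, h0⟩ := h (t i) (𝟙 _) VExt.refl (𝟙 _) (AddSubgroup.mem_top _)
  rw [Idl.mem_ker, Category.comp_id] at h0
  have key : ∀ {C : D} (f : C ⟶ t i), VExt t (t i) f → f ≫ g ≠ 0 := by
    intro C f hf
    induction hf with
    | refl => simpa using hg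
    | @step C'' C' l f a p q hT hq hf ih =>
      intro h0
      apply ih
      rw [Category.assoc] at h0
      obtain ⟨w, hw⟩ := yon3 hT (f ≫ g) h0
      rw [hw, hX l w, comp_zero]
  exact key f hf h0

lemma VLike.one_le_iota (H : VLike k t) {X : D} (i : I) (g : t i ⟶ X) (hg : g ≠ 0)
    (hX : ∀ l (u : (t l)⟦(1 : ℤ)⟧ ⟶ X), u = 0) : 1 ≤ iota t i g := by
  have := le_len (Ch.step (Ch.base (fun _ _ h => h)) (le_top _) (H.not_sm i g hg hX))
  simpa [iota] using this

lemma VLike.rho_self (H : VLike k t) (i : I) : rho t i (t i) = 1 := by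
  apply le_antisymm
  · refine len_le fun n hn => ?_
    have key : ∀ {a b : Idl (t i)} {n : ℕ}, Ch t i a b n →
        n = 0 ∨ (n = 1 ∧ ¬ Sm t i (Idl.bot _) b) := by
      intro a b n h
      induction h with
      | base h => exact Or.inl rfl
      | step h hbc hs ih =>
        rcases ih with rfl | ⟨-, h'⟩
        · exact Or.inr ⟨rfl, fun h' => hs (h'.mono (bot_le _) (fun _ _ h => h))⟩
        · exact (hs (H.simple _ _ h')).elim
    rcases key hn with rfl | ⟨rfl, -⟩ <;> simp
  · refine le_trans (H.one_le_iota i (𝟙 _) (H.id_ne i) ?_) (iota_le_source _)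
    intro l
    exact hom_shift_zero 1 (H.hshift l i (-1) (by norm_num) (by norm_num))

lemma VLike.rho_other (H : VLike k t) (i : I) (p : ℤ) (hip : ¬ (i = j ∧ p = 0)) : rho t j ((t i)⟦p⟧) = 0 := by
  refine le_antisymm (len_le fun n hn => ?_) (zero_le)
  cases hn with
  | base h => simp
  | step h hbc hs =>
    exfalso
    apply hs
    intro C π hπ u _
    obtain ⟨C', f, hf, h0⟩ := H.kill hπ i p hip u
    exact ⟨C', f, hf, by rw [h0]; exact zero_mem _⟩

end Tower

open scoped ZeroObject

variable (t) in
/-- classical generation -/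
def Gen : Prop := ∀ P : D → Prop,
      (∀ {X Y : D}, (X ≅ Y) → P X → P Y) →
      (∀ {X : D} (n : ℤ), P X → P (X⟦n⟧)) →
      (∀ T ∈ distTriang D, P T.obj₁ → P T.obj₃ → P T.obj₂) →
      (∀ {X Y : D} (s : X ⟶ Y) (r : Y ⟶ X), s ≫ r = 𝟙 X → P Y → P X) →
      (∀ i, P (t i)) → ∀ X : D, P X

lemma retract_shift {X Y : D} (s : X ⟶ Y) (r : Y ⟶ X) (h : s ≫ r = 𝟙 X) (p : ℤ) :
    s⟦p⟧' ≫ r⟦p⟧' = 𝟙 (X⟦p⟧) := by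
  rw [← CategoryTheory.Functor.map_comp, h, CategoryTheory.Functor.map_id]

variable {k : Type} [Field k] [Linear k D]

lemma fin_all (H : VLike k t) (hgen : Gen t) (X : D) :
    (∀ (j : I) (p : ℤ), rho t j (X⟦p⟧) ≠ ⊤) ∧ {q : I × ℤ | rho t q.1 (X⟦q.2⟧) ≠ 0}.Finite := by
  have hret : ∀ {X Y : D} (s : X ⟶ Y) (r : Y ⟶ X), s ≫ r = 𝟙 X →
    ((∀ (j : I) (p : ℤ), rho t j (Y⟦p⟧) ≠ ⊤) ∧ {q : I × ℤ | rho t q.1 (Y⟦q.2⟧) ≠ 0}.Finite) →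
    ((∀ (j : I) (p : ℤ), rho t j (X⟦p⟧) ≠ ⊤) ∧ {q : I × ℤ | rho t q.1 (X⟦q.2⟧) ≠ 0}.Finite) := by
    rintro X Y s r h ⟨h1, h2⟩
    have key : ∀ (j : I) (p : ℤ), rho t j (X⟦p⟧) ≤ rho t j (Y⟦p⟧) := fun j p =>
      rho_le_of_retract _ _ (retract_shift s r h p)
    refine ⟨fun j p => ne_top_of_le_ne_top (h1 j p) (key j p), h2.subset ?_⟩
    rintro ⟨j, p⟩ hq h0
    exact hq (le_antisymm (h0 ▸ key j p) (zero_le))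
  refine hgen (fun X => (∀ (j : I) (p : ℤ), rho t j (X⟦p⟧) ≠ ⊤) ∧
    {q : I × ℤ | rho t q.1 (X⟦q.2⟧) ≠ 0}.Finite) ?_ ?_ ?_ hret ?_ X
  · intro X Y e
    exact hret e.inv e.hom (by simp)
  · rintro X n ⟨h1, h2⟩
    have key : ∀ (j : I) (p : ℤ), rho t j (X⟦n⟧⟦p⟧) = rho t j (X⟦n + p⟧) := fun j p =>
      rho_iso (shiftShift X n p (n + p) rfl)
    refine ⟨fun j p => by rw [key]; exact h1 _ _, ?_⟩
    have hinj : Function.Injective (fun q : I × ℤ => (q.1, n + q.2)) := by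
      rintro ⟨a, b⟩ ⟨c, d⟩ h
      simpa using h
    refine (h2.preimage hinj.injOn).subset ?_
    rintro ⟨j, p⟩ hq
    change rho t j (X⟦n + p⟧) ≠ 0
    rw [← key]
    exact hq
  · rintro T hT ⟨h1, h2⟩ ⟨h3, h4⟩
    have key : ∀ (j : I) (p : ℤ), rho t j (T.obj₂⟦p⟧) ≤ rho t j (T.obj₁⟦p⟧) + rho t j (T.obj₃⟦p⟧) := by
      intro j p
      rw [(tri_rho T hT p).1]
      exact add_le_add (iota_le_source _) (iota_le_target _)
    refine ⟨fun j p => ne_top_of_le_ne_top ?_ (key j p), (h2.union h4).subset ?_⟩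
    · exact WithTop.add_ne_top.2 ⟨h1 j p, h3 j p⟩
    · rintro ⟨j, p⟩ hq
      by_contra hn
      simp only [Set.mem_union, Set.mem_ofPred_eq, not_or, not_not] at hn
      have := key j p
      rw [hn.1, hn.2] at this
      exact hq (le_antisymm (by simpa using this) (zero_le))
  · intro i
    have h0 : rho t i ((t i)⟦(0 : ℤ)⟧) = 1 := by
      rw [rho_iso ((shiftFunctorZero D ℤ).app (t i))]
      exact H.rho_self i
    constructor
    · intro j p
      by_cases h : i = j ∧ p = 0
      · obtain ⟨rfl, rfl⟩ := h
        rw [h0]; exact ENat.one_ne_top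
      · rw [H.rho_other i p h]; exact ENat.zero_ne_top
    · refine (Set.finite_singleton (i, (0 : ℤ))).subset ?_
      rintro ⟨j, p⟩ hq
      by_contra h
      apply hq
      apply H.rho_other
      rintro ⟨rfl, rfl⟩
      exact h rfl

variable (t j) in
/-- integer valued length -/
def nn (X : D) (p : ℤ) : ℤ := ((rho t j (X⟦p⟧)).toNat : ℤ)

variable (t j) in
/-- Euler characteristic -/
def chi (X : D) : ℤ := ∑ᶠ p : ℤ, (p.negOnePow : ℤ) * nn t j X p

lemma nn_supp (H : VLike k t) (hgen : Gen t) (X : D) : {p : ℤ | nn t j X p ≠ 0}.Finite := by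
  have hinj : Function.Injective (fun p : ℤ => (j, p)) := by
    intro a b h
    simpa using h
  refine ((fin_all H hgen X).2.preimage hinj.injOn).subset ?_
  intro p hp h0
  apply hp
  have h0' : rho t j (X⟦p⟧) = 0 := h0
  simp [nn, h0']

lemma fs {f : ℤ → ℤ} (hf : {p : ℤ | f p ≠ 0}.Finite) :
    Function.HasFiniteSupport fun p : ℤ => (p.negOnePow : ℤ) * f p := by
  refine Set.Finite.subset hf ?_
  intro p hp h0
  exact hp (by simp [h0])

lemma chi_tri (H : VLike k t) (hgen : Gen t) (T : Triangle D) (hT : T ∈ distTriang D) :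
    chi t j T.obj₂ = chi t j T.obj₁ + chi t j T.obj₃ := by
  let A : ℤ → ℤ := fun p => ((iota t j (T.mor₁⟦p⟧')).toNat : ℤ)
  let B : ℤ → ℤ := fun p => ((iota t j (T.mor₂⟦p⟧')).toNat : ℤ)
  let G : ℤ → ℤ := fun p => ((iota t j (T.mor₃⟦p⟧')).toNat : ℤ)
  have fA : ∀ p, iota t j (T.mor₁⟦p⟧') ≠ ⊤ := fun p =>
    ne_top_of_le_ne_top ((fin_all H hgen T.obj₁).1 j p) (iota_le_source _)
  have fB : ∀ p, iota t j (T.mor₂⟦p⟧') ≠ ⊤ := fun p =>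
    ne_top_of_le_ne_top ((fin_all H hgen T.obj₂).1 j p) (iota_le_source _)
  have fG : ∀ p, iota t j (T.mor₃⟦p⟧') ≠ ⊤ := fun p =>
    ne_top_of_le_ne_top ((fin_all H hgen T.obj₃).1 j p) (iota_le_source _)
  have e2 : ∀ p, nn t j T.obj₂ p = A p + B p := fun p => by
    simp only [nn, A, B]
    rw [(tri_rho T hT p).1, ENat.toNat_add (fA p) (fB p)]
    push_cast; rfl
  have e3 : ∀ p, nn t j T.obj₃ p = B p + G p := fun p => by
    simp only [nn, G, B]
    rw [(tri_rho T hT p).2.1, ENat.toNat_add (fB p) (fG p)]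
    push_cast; rfl
  have e1 : ∀ p, nn t j T.obj₁ p = G (p - 1) + A p := fun p => by
    obtain ⟨q, rfl⟩ : ∃ q, p = q + 1 := ⟨p - 1, by ring⟩
    simp only [nn, G, A, add_sub_cancel_right]
    rw [(tri_rho T hT q).2.2, ENat.toNat_add (fG q) (fA (q + 1))]
    push_cast; rfl
  have sG : {p : ℤ | G p ≠ 0}.Finite := by
    refine (nn_supp (j := j) H hgen T.obj₃).subset ?_
    intro p hp h0
    have h0' : nn t j T.obj₃ p = 0 := h0
    rw [e3] at h0'
    have b : 0 ≤ B p := Int.natCast_nonneg _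
    have g : 0 ≤ G p := Int.natCast_nonneg _
    exact hp (by omega)
  have hshift : ∑ᶠ p : ℤ, ((p - 1).negOnePow : ℤ) * G (p - 1) = ∑ᶠ p : ℤ, (p.negOnePow : ℤ) * G p :=
    finsum_comp_equiv (Equiv.subRight (1 : ℤ)) (f := fun p : ℤ => (p.negOnePow : ℤ) * G p)
  have sG' : Function.HasFiniteSupport fun p : ℤ => ((p - 1).negOnePow : ℤ) * G (p - 1) :=
    (Set.Finite.preimage (Equiv.subRight (1 : ℤ)).injective.injOn (fs sG))
  have key : ∑ᶠ p : ℤ, ((p.negOnePow : ℤ) * nn t j T.obj₁ p + (p.negOnePow : ℤ) * nn t j T.obj₃ p)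
      + ∑ᶠ p : ℤ, ((p - 1).negOnePow : ℤ) * G (p - 1) =
      ∑ᶠ p : ℤ, (p.negOnePow : ℤ) * nn t j T.obj₂ p + ∑ᶠ p : ℤ, (p.negOnePow : ℤ) * G p := by
    rw [← finsum_add_distrib (fs (nn_supp H hgen _)) (fs sG), ← finsum_add_distrib _ sG']
    · apply finsum_congr
      intro p
      rw [e1, e2, e3, Int.negOnePow_sub]
      simp
      ring
    · exact (fs (nn_supp H hgen _)).add (fs (nn_supp H hgen _))
  rw [hshift, finsum_add_distrib (fs (nn_supp H hgen _)) (fs (nn_supp H hgen _))] at key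
  unfold chi
  linarith

lemma chi_t (H : VLike k t) (i : I) [Decidable (i = j)] :
    chi t j (t i) = if i = j then 1 else 0 := by
  unfold chi
  rw [finsum_eq_single _ (0 : ℤ)]
  · split_ifs with h
    · subst h
      simp [nn, rho_iso ((shiftFunctorZero D ℤ).app (t i)), H.rho_self i]
    · simp [nn, H.rho_other (j := j) i 0 (fun h' => h h'.1)]
  · intro p hp
    simp [nn, H.rho_other (j := j) i p (fun h' => hp h'.2)]

variable (t j) in
/-- The induced map on `K₀`. -/
lemma exists_chiHom (H : VLike k t) (hgen : Gen t) :
    ∃ φ : K0 D →+ ℤ, ∀ X, φ (K0.cls D X) = chi t j X := by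
  have h : triangleRelations D ≤ (FreeAbelianGroup.lift (chi t j)).ker := by
    unfold triangleRelations
    rw [AddSubgroup.closure_le]
    rintro _ ⟨T, hT, rfl⟩
    change FreeAbelianGroup.lift (chi t j) _ = 0
    rw [map_sub, map_sub, FreeAbelianGroup.lift_apply_of, FreeAbelianGroup.lift_apply_of,
      FreeAbelianGroup.lift_apply_of, chi_tri H hgen T hT]
    ring
  refine ⟨QuotientAddGroup.lift (triangleRelations D) (FreeAbelianGroup.lift (chi t j)) h, ?_⟩
  intro X
  exact FreeAbelianGroup.lift_apply_of _ _

lemma cls_tri (T : Triangle D) (hT : T ∈ distTriang D) :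
    K0.cls D T.obj₂ = K0.cls D T.obj₁ + K0.cls D T.obj₃ := by
  have h : (QuotientAddGroup.mk (FreeAbelianGroup.of T.obj₂ - FreeAbelianGroup.of T.obj₁ -
      FreeAbelianGroup.of T.obj₃) : FreeAbelianGroup D ⧸ triangleRelations D) = 0 :=
    (QuotientAddGroup.eq_zero_iff _).2 (AddSubgroup.subset_closure ⟨T, hT, rfl⟩)
  have h' : K0.cls D T.obj₂ - K0.cls D T.obj₁ - K0.cls D T.obj₃ = 0 := h
  rw [sub_sub, sub_eq_zero] at h'
  exact h'

lemma cls_zero : K0.cls D (0 : D) = 0 := by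
  have := cls_tri _ (contractible_distinguished (0 : D))
  simpa using this

lemma cls_iso {X Y : D} (e : X ≅ Y) : K0.cls D X = K0.cls D Y := by
  have hT : Triangle.mk e.hom (0 : Y ⟶ 0) 0 ∈ distTriang D := by
    rw [Triangle.distinguished_iff_of_isZero₃ _ (isZero_zero D)]
    change IsIso e.hom
    infer_instance
  have := cls_tri _ hT
  have h2 : K0.cls D Y = K0.cls D X + K0.cls D (0 : D) := this
  rw [h2, cls_zero, add_zero]

lemma cls_shift_one (X : D) : K0.cls D (X⟦(1 : ℤ)⟧) = - K0.cls D X := by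
  have := cls_tri _ (rot_of_distTriang _ (contractible_distinguished X))
  have h2 : K0.cls D (0 : D) = K0.cls D X + K0.cls D (X⟦(1 : ℤ)⟧) := this
  rw [cls_zero] at h2
  exact (neg_eq_of_add_eq_zero_right h2.symm).symm

lemma cls_shift_mem (S : AddSubgroup (K0 D)) (X : D) (p : ℤ) :
    K0.cls D (X⟦p⟧) ∈ S ↔ K0.cls D X ∈ S := by
  have key : ∀ p : ℤ, K0.cls D (X⟦p + 1⟧) ∈ S ↔ K0.cls D (X⟦p⟧) ∈ S := by
    intro p
    rw [← cls_iso (shiftShift X p 1 (p + 1) rfl), cls_shift_one, neg_mem_iff]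
  induction p using Int.induction_on with
  | zero => rw [cls_iso ((shiftFunctorZero D ℤ).app X)]; rfl
  | succ i ih => exact (key _).trans ih
  | pred i ih =>
    have h := key (-(i : ℤ) - 1)
    rw [sub_add_cancel] at h
    exact h.symm.trans ih

lemma bounded (H : VLike k t) (hgen : Gen t) (X : D) :
    ∃ b : ℤ, ∀ (i : I) (p : ℤ), p < b → ∀ u : t i ⟶ X⟦p⟧, u = 0 := by
  refine hgen (fun X => ∃ b : ℤ, ∀ (i : I) (p : ℤ), p < b → ∀ u : t i ⟶ X⟦p⟧, u = 0) ?_ ?_ ?_ ?_ ?_ X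
  · rintro X Y e ⟨b, hb⟩
    exact ⟨b, fun i p hp => hom_iso_zero ((shiftFunctor D p).mapIso e) (hb i p hp)⟩
  · rintro X n ⟨b, hb⟩
    exact ⟨b - n, fun i p hp => hom_iso_zero (shiftShift X n p (n + p) rfl).symm
      (hb i (n + p) (by omega))⟩
  · rintro T hT ⟨b, hb⟩ ⟨b', hb'⟩
    refine ⟨min b b', fun i p hp u => ?_⟩
    obtain ⟨v, hv⟩ := (ex12 T hT p).2 _ u (hb' i p (by omega) _)
    rw [← hv, hb i p (by omega) v, zero_comp]
  · rintro X Y s r h ⟨b, hb⟩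
    refine ⟨b, fun i p hp u => ?_⟩
    rw [← Category.comp_id u, ← retract_shift s r h p, ← Category.assoc, hb i p hp (u ≫ s⟦p⟧'), zero_comp]
  · intro i
    exact ⟨0, fun l p hp => H.hshift l i p (by omega) (by omega)⟩

lemma isZero_of (hgen : Gen t) (X : D) (h : ∀ (i : I) (p : ℤ), ∀ u : t i ⟶ X⟦p⟧, u = 0) : IsZero X := by
  have key := hgen (fun Z => ∀ (n : ℤ) (u : Z ⟶ X⟦n⟧), u = 0) ?_ ?_ ?_ ?_ h X 0
  · rw [IsZero.iff_id_eq_zero]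
    exact hom_iso_zero ((shiftFunctorZero D ℤ).app X) key _
  · intro Z Z' e hZ n u
    rw [← cancel_epi e.hom, hZ n (e.hom ≫ u), comp_zero]
  · intro Z m hZ n
    exact hom_shift_zero m (hom_iso_zero (shiftShift X n (-m) (n + -m) rfl).symm (hZ _))
  · intro T hT h1 h3 n u
    obtain ⟨v, hv⟩ := Triangle.yoneda_exact₂ T hT u (h1 n _)
    rw [hv, h3 n v, comp_zero]
  · intro Z Z' s r hs hZ n u
    rw [← Category.id_comp u, ← hs, Category.assoc, hZ n (r ≫ u), comp_zero]

variable (t) in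
/-- total length -/
def tot (X : D) : ℕ := ∑ᶠ q : I × ℤ, (rho t q.1 (X⟦q.2⟧)).toNat

lemma tot_shift (X : D) (n : ℤ) : tot t (X⟦n⟧) = tot t X := by
  unfold tot
  refine (finsum_congr ?_).trans (finsum_comp_equiv ((Equiv.refl I).prodCongr (Equiv.addLeft n))
    (f := fun q : I × ℤ => (rho t q.1 (X⟦q.2⟧)).toNat))
  rintro ⟨i, p⟩
  change (rho t i (X⟦n⟧⟦p⟧)).toNat = (rho t i (X⟦n + p⟧)).toNat
  rw [rho_iso (shiftShift X n p (n + p) rfl)]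

lemma tot_lt (H : VLike k t) (hgen : Gen t) (X Y : D) (i : I) (g : t i ⟶ X) (u : X ⟶ Y)
    (w : Y ⟶ (t i)⟦(1 : ℤ)⟧) (hT : Triangle.mk g u w ∈ distTriang D) (hg : g ≠ 0)
    (hX : ∀ l (u : (t l)⟦(1 : ℤ)⟧ ⟶ X), u = 0) : tot t Y < tot t X := by
  have hι := H.one_le_iota i g hg hX
  have hw : ∀ (j : I) (q : ℤ), iota t j (w⟦q⟧') = 0 := by
    intro j q
    have h3 : rho t j ((t i)⟦q + 1⟧) = iota t j (w⟦q⟧') + iota t j (g⟦q + 1⟧') :=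
      (tri_rho _ hT q).2.2
    by_cases h : i = j ∧ q + 1 = 0
    · obtain ⟨rfl, hq⟩ := h
      rw [hq, iota_shift_zero, rho_iso ((shiftFunctorZero D ℤ).app (t i))] at h3
      have h4 := H.rho_self i
      have h5 : (1 : ℕ∞) = iota t i (w⟦q⟧') + iota t i g := by rw [← h3, ← h4]; rfl
      have h6 : iota t i (w⟦q⟧') + 1 ≤ 0 + 1 := by
        rw [zero_add]
        calc _ ≤ _ := add_le_add le_rfl hι
          _ = 1 := h5.symm
      exact le_antisymm ((ENat.add_le_add_iff_right ENat.one_ne_top).1 h6) (zero_le)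
    · rw [H.rho_other i _ h] at h3
      exact (add_eq_zero.1 h3.symm).1
  have hY : ∀ (j : I) (q : ℤ), rho t j (Y⟦q⟧) = iota t j (u⟦q⟧') := by
    intro j q
    have := (tri_rho (t := t) (j := j) _ hT q).2.1
    have h : rho t j (Y⟦q⟧) = iota t j (u⟦q⟧') + iota t j (w⟦q⟧') := this
    rw [h, hw, add_zero]
  have hX' : ∀ (j : I) (q : ℤ), rho t j (X⟦q⟧) = iota t j (g⟦q⟧') + rho t j (Y⟦q⟧) := by
    intro j q
    rw [hY]
    exact (tri_rho (t := t) (j := j) _ hT q).1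
  have hle : ∀ q : I × ℤ, (rho t q.1 (Y⟦q.2⟧)).toNat ≤ (rho t q.1 (X⟦q.2⟧)).toNat := by
    intro q
    apply ENat.toNat_le_toNat _ ((fin_all H hgen X).1 _ _)
    rw [hX']
    exact le_add_self
  have hlt : (rho t i (Y⟦(0 : ℤ)⟧)).toNat < (rho t i (X⟦(0 : ℤ)⟧)).toNat := by
    have h1 : rho t i (Y⟦(0 : ℤ)⟧) + 1 ≤ rho t i (X⟦(0 : ℤ)⟧) := by
      rw [hX', iota_shift_zero, add_comm]
      exact add_le_add hι le_rfl
    have h2 := ENat.toNat_le_toNat h1 ((fin_all H hgen X).1 _ _)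
    rw [ENat.toNat_add ((fin_all H hgen Y).1 _ _) ENat.one_ne_top] at h2
    simp at h2
    omega
  have hs := (fin_all H hgen X).2
  have sub1 : (Function.support fun q : I × ℤ => (rho t q.1 (X⟦q.2⟧)).toNat) ⊆ hs.toFinset := by
    intro q hq
    rw [Set.Finite.coe_toFinset]
    intro h0
    exact hq (by simp [h0])
  have sub2 : (Function.support fun q : I × ℤ => (rho t q.1 (Y⟦q.2⟧)).toNat) ⊆ hs.toFinset := by
    refine subset_trans ?_ sub1
    intro q hq h0
    have := hle q
    have h0' : (rho t q.1 (X⟦q.2⟧)).toNat = 0 := h0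
    exact hq (by simp only; omega)
  unfold tot
  rw [finsum_eq_sum_of_support_subset _ sub1, finsum_eq_sum_of_support_subset _ sub2]
  refine Finset.sum_lt_sum (fun q _ => hle q) ⟨(i, 0), ?_, hlt⟩
  have : (i, (0 : ℤ)) ∈ (hs.toFinset : Set (I × ℤ)) := sub1 (by
    change (rho t i (X⟦(0 : ℤ)⟧)).toNat ≠ 0
    omega)
  exact this

lemma gen_mem (H : VLike k t) (hgen : Gen t) (S : AddSubgroup (K0 D))
    (hS : ∀ i, K0.cls D (t i) ∈ S) : ∀ (n : ℕ) (X : D), tot t X = n → K0.cls D X ∈ S := by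
  intro n
  induction n using Nat.strong_induction_on with
  | _ n ih =>
    intro X hn
    by_cases hz : ∀ (i : I) (p : ℤ), ∀ u : t i ⟶ X⟦p⟧, u = 0
    · rw [cls_iso (isZero_of hgen X hz).isoZero, cls_zero]
      exact zero_mem _
    · push Not at hz
      obtain ⟨i0, p0, u0, hu0⟩ := hz
      obtain ⟨b, hb⟩ := bounded H hgen X
      obtain ⟨p, ⟨i, g, hg⟩, hmin⟩ := Int.exists_least_of_bdd
        (P := fun p : ℤ => ∃ (i : I) (u : t i ⟶ X⟦p⟧), u ≠ 0)
        ⟨b, fun z hz => by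
          obtain ⟨i, u, hu⟩ := hz
          by_contra hlt
          exact hu (hb i z (by omega) u)⟩ ⟨p0, i0, u0, hu0⟩
      rw [← cls_shift_mem S X p]
      obtain ⟨Y, u, w, hT⟩ := distinguished_cocone_triangle g
      have hX : ∀ l (u : (t l)⟦(1 : ℤ)⟧ ⟶ X⟦p⟧), u = 0 := by
        intro l
        apply hom_shift_zero 1
        apply hom_iso_zero (shiftShift X p (-1) (p + -1) rfl).symm
        intro u
        by_contra hu
        have := hmin _ ⟨l, u, hu⟩
        omega
      have hlt := tot_lt H hgen _ Y i g u w hT hg hX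
      rw [tot_shift, hn] at hlt
      have h : K0.cls D (X⟦p⟧) = K0.cls D (t i) + K0.cls D Y := cls_tri _ hT
      rw [h]
      exact add_mem (hS i) (ih _ hlt Y rfl)

end Aux

end VL

theorem K0_free_on_vertex_like_generators
    (k : Type) [Field k] [Linear k D]
    {I : Type} (t : I → D)
    -- Hom(t_i, t_i) = k (spanned by the identity)
    (hend : ∀ i, Function.Bijective (algebraMap k (End (t i))))
    -- Hom(t_i, t_j) = 0 for i ≠ j
    (hhom : ∀ i j, i ≠ j → ∀ f : t i ⟶ t j, f = 0)
    -- Hom^p(t_i, t_j) = 0 for p ∉ {0, 1}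
    (hshift : ∀ i j (p : ℤ), p ≠ 0 → p ≠ 1 → ∀ f : t i ⟶ (t j)⟦p⟧, f = 0)
    -- the family classically generates `D`: any thick subcategory containing all
    -- the `t_i` contains every object
    (hgen : ∀ P : D → Prop,
      (∀ {X Y : D}, (X ≅ Y) → P X → P Y) →
      (∀ {X : D} (n : ℤ), P X → P (X⟦n⟧)) →
      (∀ T ∈ distTriang D, P T.obj₁ → P T.obj₃ → P T.obj₂) →
      (∀ {X Y : D} (s : X ⟶ Y) (r : Y ⟶ X), s ≫ r = 𝟙 X → P Y → P X) →
      (∀ i, P (t i)) → ∀ X : D, P X) :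
    Function.Bijective
      (Finsupp.liftAddHom (α := I) (M := ℤ) (N := K0 D)
        (fun i => (zmultiplesHom (K0 D)) (K0.cls D (t i)))) := by
  classical
  have H : VL.VLike k t := ⟨hend, hhom, hshift⟩
  have hG : VL.Gen t := fun P h1 h2 h3 h4 h5 => hgen P h1 h2 h3 h4 h5
  have hval : ∀ i (n : ℤ), (Finsupp.liftAddHom (α := I) (M := ℤ) (N := K0 D)
      (fun i => (zmultiplesHom (K0 D)) (K0.cls D (t i)))) (Finsupp.single i n) =
      n • K0.cls D (t i) := by
    intro i n
    rw [Finsupp.liftAddHom_apply_single, zmultiplesHom_apply]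
  constructor
  · rw [injective_iff_map_eq_zero]
    intro s hs
    ext j
    obtain ⟨φ, hφ⟩ := VL.exists_chiHom t j H hG
    have hc : φ.comp (Finsupp.liftAddHom (α := I) (M := ℤ) (N := K0 D)
        (fun i => (zmultiplesHom (K0 D)) (K0.cls D (t i)))) = Finsupp.applyAddHom j := by
      apply Finsupp.addHom_ext
      intro i n
      rw [AddMonoidHom.comp_apply, hval, map_zsmul, hφ, VL.chi_t H i]
      by_cases h : i = j
      · simp [h]
      · simp [h]
    have h1 := DFunLike.congr_fun hc s
    rw [AddMonoidHom.comp_apply, hs, map_zero] at h1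
    exact h1.symm
  · intro x
    have hcls : ∀ X : D, K0.cls D X ∈ (Finsupp.liftAddHom (α := I) (M := ℤ) (N := K0 D)
        (fun i => (zmultiplesHom (K0 D)) (K0.cls D (t i)))).range := fun X =>
      VL.gen_mem H hG (Finsupp.liftAddHom (α := I) (M := ℤ) (N := K0 D)
        (fun i => (zmultiplesHom (K0 D)) (K0.cls D (t i)))).range
        (fun i => AddMonoidHom.mem_range.2 ⟨Finsupp.single i 1, by rw [hval, one_smul]⟩) _ X rfl
    change x ∈ (Finsupp.liftAddHom (α := I) (M := ℤ) (N := K0 D)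
        (fun i => (zmultiplesHom (K0 D)) (K0.cls D (t i)))).range
    obtain ⟨y, rfl⟩ := QuotientAddGroup.mk_surjective x
    induction y using FreeAbelianGroup.induction_on with
    | zero => exact zero_mem _
    | of X => exact hcls X
    | neg X _ => exact neg_mem (hcls X)
    | add a b ha hb => exact add_mem ha hb

end
end
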